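/- Let N ≥ 1, s ∈ (0,2), β ≥ 0, and θ ∈ S(ℝ^N). Then for every x ∈ ℝ^N the pointwise inequality |θ(x)|^β θ(x) Λ^s θ(x) ≥ (1/(β+2)) Λ^s(|θ|^{β+2})(x) holds, where Λ^s(|θ|^{β+2}) is given by the same absolutely convergent symmetrized singular integral (which converges since |θ|^{β+2} is a bounded C² function with bounded derivatives and rapid decay). -/

import Mathlib

open MeasureTheory Filter Topology SchwartzMap
open scoped ENNReal

/-- The fractional Laplacian `Λ^s` of order `0 < s < 2` with constant `c`, defined through the
symmetrized singular integral. -/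
noncomputable def fracLapSI (N : ℕ) (c s : ℝ) (f : EuclideanSpace ℝ (Fin N) → ℝ)
    (x : EuclideanSpace ℝ (Fin N)) : ℝ :=
  (c / 2) * ∫ y : EuclideanSpace ℝ (Fin N),
    (2 * f x - f (x + y) - f (x - y)) / ‖y‖ ^ ((N : ℝ) + s)

theorem integrable_div_norm_rpow_of_sq_bound {N : ℕ} (hN : 1 ≤ N) {s : ℝ} (hs0 : 0 < s)
    (hs2 : s < 2) {g : EuclideanSpace ℝ (Fin N) → ℝ} (hg : Continuous g) {A B : ℝ} (hA : 0 ≤ A)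
    (hgA : ∀ y, |g y| ≤ A * ‖y‖ ^ 2) (hgB : ∀ y, |g y| ≤ B) :
    Integrable (fun y => g y / ‖y‖ ^ ((N : ℝ) + s)) volume := by
  have : Nonempty (Fin N) := ⟨⟨0, hN⟩⟩
  have : Nontrivial (EuclideanSpace ℝ (Fin N)) := inferInstance
  set f : ℝ → ℝ := fun r => if r ≤ 1 then A * r ^ (2 - (N : ℝ) - s) else B * r ^ (-(N : ℝ) - s)
    with hf
  have hpow : ∀ r : ℝ, 0 < r → ∀ a : ℝ, r ^ (N - 1) * r ^ a = r ^ ((N : ℝ) - 1 + a) := by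
    intro r hr a
    rw [Real.rpow_add hr, ← Real.rpow_natCast, Nat.cast_sub hN, Nat.cast_one]
  have hint : IntegrableOn (fun r : ℝ => r ^ (N - 1) • f r) (Set.Ioi 0) := by
    rw [← Set.Ioc_union_Ioi_eq_Ioi (zero_le_one (α := ℝ))]
    refine IntegrableOn.union ?_ ?_
    · have h : IntegrableOn (fun r : ℝ => A * r ^ (1 - s)) (Set.Ioc 0 1) := by
        refine Integrable.const_mul ?_ A
        exact (intervalIntegrable_iff_integrableOn_Ioc_of_le zero_le_one).1
          (intervalIntegral.intervalIntegrable_rpow' (by linarith))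
      refine h.congr_fun (fun r hr => ?_) measurableSet_Ioc
      simp only [hf, if_pos hr.2, smul_eq_mul]
      rw [mul_left_comm, hpow r hr.1]
      congr 2; ring
    · have h : IntegrableOn (fun r : ℝ => B * r ^ (-1 - s)) (Set.Ioi 1) :=
        Integrable.const_mul (integrableOn_Ioi_rpow_of_lt (by linarith) one_pos) B
      refine h.congr_fun (fun r hr => ?_) measurableSet_Ioi
      have hr' : (1 : ℝ) < r := hr
      simp only [hf, if_neg hr'.not_ge, smul_eq_mul]
      rw [mul_left_comm, hpow r (by linarith)]
      congr 2; ring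
  have hint' : Integrable (fun y : EuclideanSpace ℝ (Fin N) => f ‖y‖) volume := by
    rw [integrable_fun_norm_addHaar]
    simpa using hint
  refine hint'.mono' ?_ (Eventually.of_forall fun y => ?_)
  · exact (hg.measurable.div (measurable_norm.pow_const _)).aestronglyMeasurable
  · rw [Real.norm_eq_abs, abs_div, abs_of_nonneg (Real.rpow_nonneg (norm_nonneg y) _)]
    rcases eq_or_lt_of_le (norm_nonneg y) with h0 | h0
    · have : |g y| = 0 := le_antisymm (by simpa [← h0] using hgA y) (abs_nonneg _)
      rw [this, zero_div]
      simp only [hf, ← h0, zero_le_one, if_true]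
      positivity
    · simp only [hf]
      split_ifs with h1
      · have : (2 : ℝ) - N - s = 2 - (N + s) := by ring
        rw [this, Real.rpow_sub h0, Real.rpow_two, ← mul_div_assoc]
        exact div_le_div_of_nonneg_right (hgA y) (by positivity)
      · have : -(N : ℝ) - s = -(N + s) := by ring
        rw [this, Real.rpow_neg h0.le, ← div_eq_mul_inv]
        exact div_le_div_of_nonneg_right (hgB y) (by positivity)

theorem abs_rpow_tangent_le {β : ℝ} (hβ : 0 ≤ β) (a b : ℝ) :
    |a| ^ (β + 2) + (β + 2) * (|a| ^ β * a) * (b - a) ≤ |b| ^ (β + 2) := by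
  have hp : 0 < β + 2 := by linarith
  have key := Real.geom_mean_le_arith_mean2_weighted (w₁ := (β + 1) / (β + 2))
    (w₂ := 1 / (β + 2)) (p₁ := |a| ^ (β + 2)) (p₂ := |b| ^ (β + 2)) (by positivity)
    (by positivity) (by positivity) (by positivity) (by field_simp; ring)
  rw [← Real.rpow_mul (abs_nonneg a), ← Real.rpow_mul (abs_nonneg b),
    mul_div_cancel₀ _ hp.ne', mul_div_cancel₀ _ hp.ne', Real.rpow_one] at key
  have h1 : |a| ^ (β + 1) = |a| ^ β * |a| := by
    rw [Real.rpow_add_of_nonneg (abs_nonneg a) hβ zero_le_one, Real.rpow_one]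
  have h2 : |a| ^ (β + 2) = |a| ^ β * a * a := by
    rw [Real.rpow_add_of_nonneg (abs_nonneg a) hβ zero_le_two, Real.rpow_two, sq_abs]; ring
  have h3 : |a| ^ β * a * b ≤ |a| ^ (β + 1) * |b| := by
    rw [h1, mul_assoc, mul_assoc, ← abs_mul]
    exact mul_le_mul_of_nonneg_left (le_abs_self _) (by positivity)
  have h4 : (β + 2) * ((β + 1) / (β + 2) * |a| ^ (β + 2) + 1 / (β + 2) * |b| ^ (β + 2))
      = (β + 1) * |a| ^ (β + 2) + |b| ^ (β + 2) := by
    field_simp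
  have h5 := mul_le_mul_of_nonneg_left (h3.trans key) hp.le
  rw [h4] at h5
  nlinarith

theorem abs_rpow_mul_self_sub_le {β : ℝ} (hβ : 0 ≤ β) {M a b : ℝ} (ha : |a| ≤ M) (hb : |b| ≤ M) :
    |(|b| ^ β * b - |a| ^ β * a)| ≤ 2 * ((β + 1) * M ^ β) * |b - a| := by
  have hM : 0 ≤ M := (abs_nonneg a).trans ha
  have hlip : ∀ u ∈ Set.Icc 0 M, ∀ v ∈ Set.Icc 0 M,
      |v ^ (β + 1) - u ^ (β + 1)| ≤ (β + 1) * M ^ β * |v - u| := by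
    intro u hu v hv
    refine Convex.norm_image_sub_le_of_norm_hasDerivWithin_le
      (f := fun t : ℝ => t ^ (β + 1)) (f' := fun t => (β + 1) * t ^ β)
      (fun t _ => ?_) (fun t ht => ?_) (convex_Icc 0 M) hu hv
    · have := Real.hasDerivAt_rpow_const (x := t) (p := β + 1) (Or.inr (by linarith))
      rw [add_sub_cancel_right] at this
      exact this.hasDerivWithinAt
    · have := Real.rpow_nonneg ht.1 β
      rw [Real.norm_eq_abs, abs_of_nonneg (by positivity)]
      have := Real.rpow_le_rpow ht.1 ht.2 hβ
      gcongr
  have hdec : ∀ t : ℝ, |t| ^ β * t = max t 0 ^ (β + 1) - max (-t) 0 ^ (β + 1) := by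
    intro t
    have h0 : (0 : ℝ) ^ (β + 1) = 0 := Real.zero_rpow (by linarith)
    rcases le_total 0 t with ht | ht
    · rw [max_eq_left ht, max_eq_right (by linarith), h0, abs_of_nonneg ht,
        Real.rpow_add_of_nonneg ht hβ zero_le_one, Real.rpow_one, sub_zero]
    · rw [max_eq_right ht, max_eq_left (by linarith), h0, abs_of_nonpos ht,
        Real.rpow_add_of_nonneg (by linarith) hβ zero_le_one, Real.rpow_one]
      ring
  have hmem : ∀ t : ℝ, |t| ≤ M → max t 0 ∈ Set.Icc 0 M := fun t ht =>
    ⟨le_max_right _ _, max_le ((le_abs_self t).trans ht) hM⟩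
  have h1 := hlip _ (hmem a ha) _ (hmem b hb)
  have h2 := hlip _ (hmem (-a) (by rwa [abs_neg])) _ (hmem (-b) (by rwa [abs_neg]))
  have m1 : |max b 0 - max a 0| ≤ |b - a| := by
    simpa using abs_max_sub_max_le_abs b a 0
  have m2 : |max (-b) 0 - max (-a) 0| ≤ |b - a| := by
    have := abs_max_sub_max_le_abs (-b) (-a) 0
    rwa [neg_sub_neg, abs_sub_comm a b] at this
  have hK : 0 ≤ (β + 1) * M ^ β := by positivity
  have m3 := mul_le_mul_of_nonneg_left m1 hK
  have m4 := mul_le_mul_of_nonneg_left m2 hK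
  rw [hdec a, hdec b]
  rw [abs_le] at *
  constructor <;> linarith [h1.1, h1.2, h2.1, h2.2]

theorem abs_rpow_le_tangent_add_sq {β : ℝ} (hβ : 0 ≤ β) {M a b : ℝ} (ha : |a| ≤ M)
    (hb : |b| ≤ M) :
    |b| ^ (β + 2) ≤ |a| ^ (β + 2) + (β + 2) * (|a| ^ β * a) * (b - a)
      + (β + 2) * (2 * ((β + 1) * M ^ β)) * (b - a) ^ 2 := by
  have h1 := abs_rpow_tangent_le hβ b a
  have h2 : (|b| ^ β * b - |a| ^ β * a) * (b - a)
      ≤ 2 * ((β + 1) * M ^ β) * (b - a) ^ 2 := by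
    refine (le_abs_self _).trans ?_
    rw [abs_mul, ← sq_abs (b - a), pow_two, ← mul_assoc]
    exact mul_le_mul_of_nonneg_right (abs_rpow_mul_self_sub_le hβ ha hb) (abs_nonneg _)
  have h3 := mul_le_mul_of_nonneg_left h2 (by linarith : 0 ≤ β + 2)
  linarith

namespace SchwartzMap

variable {E F : Type*} [NormedAddCommGroup E] [NormedSpace ℝ E] [NormedAddCommGroup F]
  [NormedSpace ℝ F]

theorem exists_norm_le (f : 𝓢(E, F)) : ∃ C, 0 ≤ C ∧ ∀ x, ‖f x‖ ≤ C := by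
  obtain ⟨C, -, hC⟩ := f.decay 0 0
  have h : ∀ x, ‖f x‖ ≤ C := fun x => by simpa using hC x
  exact ⟨C, (norm_nonneg _).trans (h 0), h⟩

theorem exists_norm_fderiv_le (f : 𝓢(E, F)) : ∃ C, 0 ≤ C ∧ ∀ x, ‖fderiv ℝ f x‖ ≤ C := by
  obtain ⟨C, -, hC⟩ := f.decay 0 1
  have h : ∀ x, ‖fderiv ℝ f x‖ ≤ C := fun x => by
    have := hC x
    rw [norm_iteratedFDeriv_one] at this
    simpa using this
  exact ⟨C, (norm_nonneg _).trans (h 0), h⟩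

theorem exists_norm_sub_le (f : 𝓢(E, F)) : ∃ C, 0 ≤ C ∧ ∀ x y, ‖f y - f x‖ ≤ C * ‖y - x‖ := by
  obtain ⟨C, hC0, hC⟩ := f.exists_norm_fderiv_le
  exact ⟨C, hC0, fun x y => convex_univ.norm_image_sub_le_of_norm_fderiv_le
    (fun z _ => f.differentiableAt) (fun z _ => hC z) trivial trivial⟩

theorem exists_norm_sub_sub_fderiv_le (f : 𝓢(E, F)) :
    ∃ C, 0 ≤ C ∧ ∀ x y, ‖f (x + y) - f x - fderiv ℝ f x y‖ ≤ C * ‖y‖ ^ 2 := by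
  obtain ⟨C, hC0, hC⟩ := (fderivCLM ℝ E F f).exists_norm_sub_le
  refine ⟨C, hC0, fun x y => ?_⟩
  have h := (convex_closedBall x ‖y‖).norm_image_sub_le_of_norm_fderiv_le' (𝕜 := ℝ) (f := f)
    (φ := fderiv ℝ f x) (C := C * ‖y‖) (x := x) (y := x + y)
    (fun z _ => f.differentiableAt) (fun z hz => ?_) (by simp) (by simp)
  · rw [add_sub_cancel_left] at h
    rwa [pow_two, ← mul_assoc]
  · have h1 := hC x z
    simp only [fderivCLM_apply] at h1
    refine h1.trans (mul_le_mul_of_nonneg_left ?_ hC0)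
    rwa [mem_closedBall_iff_norm] at hz

theorem exists_norm_second_difference_le (f : 𝓢(E, F)) :
    ∃ C, 0 ≤ C ∧ ∀ x y, ‖(2 : ℝ) • f x - f (x + y) - f (x - y)‖ ≤ C * ‖y‖ ^ 2 := by
  obtain ⟨C, hC0, hC⟩ := f.exists_norm_sub_sub_fderiv_le
  refine ⟨2 * C, by positivity, fun x y => ?_⟩
  have h1 := hC x y
  have h2 := hC x (-y)
  rw [norm_neg, map_neg, ← sub_eq_add_neg] at h2
  have : (2 : ℝ) • f x - f (x + y) - f (x - y)
      = -((f (x + y) - f x - fderiv ℝ f x y) + (f (x - y) - f x - -fderiv ℝ f x y)) := by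
    rw [two_smul]; abel
  rw [this, norm_neg]
  exact (norm_add_le _ _).trans (by linarith)

end SchwartzMap

/-- Let `N ≥ 1`, `s ∈ (0,2)`, `β ≥ 0` and `θ ∈ S(ℝ^N)`.  Then for every
`x ∈ ℝ^N` the pointwise inequality `|θ(x)|^β θ(x) Λ^s θ(x) ≥ (1/(β+2)) Λ^s(|θ|^{β+2})(x)`
holds, where `Λ^s (|θ|^{β+2})` is given by the same absolutely convergent symmetrized
singular integral. -/
theorem statement2 (N : ℕ) (hN : 1 ≤ N) (s : ℝ) (hs0 : 0 < s) (hs2 : s < 2)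
    (β : ℝ) (hβ : 0 ≤ β) (c : ℝ) (hc : 0 < c)
    (θ : SchwartzMap (EuclideanSpace ℝ (Fin N)) ℝ) (x : EuclideanSpace ℝ (Fin N)) :
    Integrable (fun y : EuclideanSpace ℝ (Fin N) =>
        (2 * |θ x| ^ (β + 2) - |θ (x + y)| ^ (β + 2) - |θ (x - y)| ^ (β + 2))
          / ‖y‖ ^ ((N : ℝ) + s)) volume ∧
    (1 / (β + 2)) * fracLapSI N c s (fun z => |θ z| ^ (β + 2)) x
      ≤ |θ x| ^ β * θ x * fracLapSI N c s (⇑θ) x := by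
  have hp : 0 < β + 2 := by linarith
  obtain ⟨M, hM0, hM⟩ := θ.exists_norm_le
  obtain ⟨L, hL0, hL⟩ := θ.exists_norm_sub_le
  obtain ⟨D, hD0, hD⟩ := θ.exists_norm_second_difference_le
  simp only [Real.norm_eq_abs, smul_eq_mul] at hM hL hD
  have hcont : Continuous θ := θ.continuous
  have hθ : Integrable (fun y => (2 * θ x - θ (x + y) - θ (x - y)) / ‖y‖ ^ ((N : ℝ) + s))
      volume := by
    refine integrable_div_norm_rpow_of_sq_bound hN hs0 hs2 (by fun_prop) hD0
      (B := 4 * M) (hD x) (fun y => ?_)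
    have h1 := abs_le.1 (hM x)
    have h2 := abs_le.1 (hM (x + y))
    have h3 := abs_le.1 (hM (x - y))
    exact abs_le.2 ⟨by linarith, by linarith⟩
  set T := (β + 2) * (|θ x| ^ β * θ x) with hT
  have hupper : ∀ y, 2 * |θ x| ^ (β + 2) - |θ (x + y)| ^ (β + 2) - |θ (x - y)| ^ (β + 2)
      ≤ T * (2 * θ x - θ (x + y) - θ (x - y)) := fun y => by
    have h1 := abs_rpow_tangent_le hβ (θ x) (θ (x + y))
    have h2 := abs_rpow_tangent_le hβ (θ x) (θ (x - y))
    rw [← hT] at h1 h2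
    linarith
  set K := (β + 2) * (2 * ((β + 1) * M ^ β)) with hK
  have hK0 : 0 ≤ K := by positivity
  have hlower : ∀ y, T * (2 * θ x - θ (x + y) - θ (x - y)) - 2 * K * L ^ 2 * ‖y‖ ^ 2
      ≤ 2 * |θ x| ^ (β + 2) - |θ (x + y)| ^ (β + 2) - |θ (x - y)| ^ (β + 2) := fun y => by
    have h1 := abs_rpow_le_tangent_add_sq hβ (hM x) (hM (x + y))
    have h2 := abs_rpow_le_tangent_add_sq hβ (hM x) (hM (x - y))
    rw [← hT, ← hK] at h1 h2
    have hsq : ∀ z, ‖z - x‖ = ‖y‖ → K * (θ z - θ x) ^ 2 ≤ K * (L ^ 2 * ‖y‖ ^ 2) := by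
      intro z hz
      have := hL x z
      rw [hz] at this
      rw [← sq_abs (θ z - θ x), ← mul_pow]
      gcongr
    have h3 := hsq (x + y) (by simp)
    have h4 := hsq (x - y) (by simp)
    linarith
  have hint : Integrable (fun y : EuclideanSpace ℝ (Fin N) =>
      (2 * |θ x| ^ (β + 2) - |θ (x + y)| ^ (β + 2) - |θ (x - y)| ^ (β + 2))
        / ‖y‖ ^ ((N : ℝ) + s)) volume := by
    have hpc : Continuous fun z => |θ z| ^ (β + 2) :=
      hcont.abs.rpow_const fun _ => Or.inr hp.le
    refine integrable_div_norm_rpow_of_sq_bound hN hs0 hs2 (A := |T| * D + 2 * K * L ^ 2)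
      (B := 4 * M ^ (β + 2)) ?_ (by positivity) (fun y => ?_) (fun y => ?_)
    · exact (continuous_const.sub (hpc.comp (continuous_const.add continuous_id))).sub
        (hpc.comp (continuous_const.sub continuous_id))
    · have h1 : |T * (2 * θ x - θ (x + y) - θ (x - y))| ≤ |T| * (D * ‖y‖ ^ 2) := by
        rw [abs_mul]
        exact mul_le_mul_of_nonneg_left (hD x y) (abs_nonneg _)
      have h2 := abs_le.1 h1
      have h3 := hupper y
      have h4 := hlower y
      have h5 : 0 ≤ 2 * K * L ^ 2 * ‖y‖ ^ 2 := by positivity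
      exact abs_le.2 ⟨by linarith, by linarith⟩
    · have hb : ∀ z, 0 ≤ |θ z| ^ (β + 2) ∧ |θ z| ^ (β + 2) ≤ M ^ (β + 2) := fun z =>
        ⟨by positivity, Real.rpow_le_rpow (abs_nonneg _) (hM z) hp.le⟩
      have h1 := hb x
      have h2 := hb (x + y)
      have h3 := hb (x - y)
      exact abs_le.2 ⟨by linarith, by linarith⟩
  refine ⟨hint, ?_⟩
  have hmono := integral_mono hint (hθ.const_mul T) fun y => by
    simp only [← mul_div_assoc]
    exact div_le_div_of_nonneg_right (hupper y) (by positivity)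
  rw [integral_const_mul] at hmono
  have h := mul_le_mul_of_nonneg_left hmono (by positivity : 0 ≤ 1 / (β + 2) * (c / 2))
  simp only [fracLapSI]
  calc _ = _ := (mul_assoc _ _ _).symm
    _ ≤ _ := h
    _ = _ := by rw [hT]; field_simp
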